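/- For every simplicial set X, the map τ_X : N(Δ↓X) → X from the nerve of the category of simplices of X is a weak homotopy equivalence. -/

import Mathlib

open CategoryTheory CategoryTheory.Limits Simplicial MonoidalCategory SSet

noncomputable instance : MonoidalClosed SSet.{0} :=
  (inferInstance : MonoidalClosed (SimplexCategoryᵒᵖ ⥤ Type 0))

namespace Paper

/-- A map of simplicial sets is a *trivial fibration* if it has the right lifting
property with respect to all boundary inclusions `∂Δ[n] ⟶ Δ[n]` for `n ≥ 0`. -/
def TrivialFibration {X Y : SSet.{0}} (p : X ⟶ Y) : Prop :=
  ∀ n : ℕ, HasLiftingProperty (SSet.boundary.{0} n).ι p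

/-- A map of simplicial sets is a *Kan fibration* if it has the right lifting property
with respect to all horn inclusions `Λ[n, i] ⟶ Δ[n]` for `n ≥ 1`, `0 ≤ i ≤ n`. -/
def KanFibration {X Y : SSet.{0}} (p : X ⟶ Y) : Prop :=
  ∀ (n : ℕ) (i : Fin (n + 2)), HasLiftingProperty (SSet.horn.{0} (n + 1) i).ι p

/-- An *anodyne* map is one with the left lifting property with respect to
all Kan fibrations. -/
def Anodyne {A B : SSet.{0}} (i : A ⟶ B) : Prop :=
  ∀ ⦃X Y : SSet.{0}⦄ (p : X ⟶ Y), KanFibration p → HasLiftingProperty i p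

/-- The unique map to `Δ[0]`. -/
def toPt (X : SSet.{0}) : X ⟶ Δ[0] where
  app m := ↾fun _ => SSet.stdSimplex.const 0 0 m
  naturality := by
    intro m m' φ
    apply ConcreteCategory.hom_ext
    intro x
    apply stdSimplex.objEquiv.injective
    apply SimplexCategory.Hom.ext
    apply OrderHom.ext
    funext j
    exact @Subsingleton.elim (Fin 1) _ _ _

/-- A *Kan complex* is a simplicial set whose map to `Δ[0]` is a Kan fibration. -/
def KanComplex (X : SSet.{0}) : Prop :=
  KanFibration (toPt X)

/-- The constant map at the vertex `k` of `Δ[1]`. -/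
def cst (X : SSet.{0}) (k : Fin 2) : X ⟶ Δ[1] where
  app m := ↾fun _ => SSet.stdSimplex.const 1 k m
  naturality := by
    intro m m' φ
    apply ConcreteCategory.hom_ext
    intro x
    apply stdSimplex.objEquiv.injective
    apply SimplexCategory.Hom.ext
    ext j
    rfl

/-- The endpoint inclusion `X ⟶ X ⊗ Δ[1]` at the vertex `k` of `Δ[1]`. -/
noncomputable def ept (X : SSet.{0}) (k : Fin 2) : X ⟶ X ⊗ Δ[1] :=
  CartesianMonoidalCategory.lift (𝟙 X) (cst X k)

/-- A (single-step) homotopy from `f` to `g`, as a property of the pair `(f, g)`. -/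
def Homotopy {X Y : SSet.{0}} (f g : X ⟶ Y) : Prop :=
  ∃ H : X ⊗ Δ[1] ⟶ Y, ept X 0 ≫ H = f ∧ ept X 1 ≫ H = g

/-- `f` and `g` are *homotopic* if they are connected by a zig-zag of homotopies. -/
def Homotopic {X Y : SSet.{0}} (f g : X ⟶ Y) : Prop :=
  Relation.EqvGen Homotopy f g

/-- A *homotopy equivalence* of simplicial sets. -/
def HomotopyEquivalence {X Y : SSet.{0}} (f : X ⟶ Y) : Prop :=
  ∃ g : Y ⟶ X, Homotopic (f ≫ g) (𝟙 X) ∧ Homotopic (g ≫ f) (𝟙 Y)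

/-- A map `f : X ⟶ Y` is a *weak homotopy equivalence* if for every Kan complex `K`
the induced map `K^Y ⟶ K^X` on exponentials is a homotopy equivalence. -/
def WeakHomotopyEquivalence {X Y : SSet.{0}} (f : X ⟶ Y) : Prop :=
  ∀ K : SSet.{0}, KanComplex K → HomotopyEquivalence ((MonoidalClosed.pre f).app K)

/-- A homotopy `H` between maps over `B` which is *fiberwise over `B`*. -/
def FibHomotopy {B X Y : SSet.{0}} (pX : X ⟶ B) (pY : Y ⟶ B) (f g : X ⟶ Y) : Prop :=
  ∃ H : X ⊗ Δ[1] ⟶ Y, ept X 0 ≫ H = f ∧ ept X 1 ≫ H = g ∧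
    H ≫ pY = CartesianMonoidalCategory.fst X Δ[1] ≫ pX

/-- Connectedness by a zig-zag of fiberwise homotopies over `B`. -/
def FibHomotopic {B X Y : SSet.{0}} (pX : X ⟶ B) (pY : Y ⟶ B) (f g : X ⟶ Y) : Prop :=
  Relation.EqvGen (FibHomotopy pX pY) f g

/-- A *fiberwise homotopy equivalence over `B`*. -/
def FibHomotopyEquivalence {B X Y : SSet.{0}} (pX : X ⟶ B) (pY : Y ⟶ B) (f : X ⟶ Y) : Prop :=
  f ≫ pY = pX ∧ ∃ g : Y ⟶ X, g ≫ pX = pY ∧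
    FibHomotopic pX pX (f ≫ g) (𝟙 X) ∧ FibHomotopic pY pY (g ≫ f) (𝟙 Y)

end Paper

namespace Paper

/-- The category of simplices `Δ ↓ X` of a simplicial set `X`:
objects are pairs `([n], x)` with `x ∈ X_n`, and morphisms `([m], y) ⟶ ([n], x)`
are simplicial operators `φ : [m] ⟶ [n]` with `x · φ = y`. -/
structure SimplexOf (X : SSet.{0}) : Type where
  dim : SimplexCategory
  pt : X.obj (Opposite.op dim)

instance (X : SSet.{0}) : Category (SimplexOf X) where
  Hom a b := { φ : a.dim ⟶ b.dim // X.map φ.op b.pt = a.pt }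
  id a := ⟨𝟙 a.dim, by simp⟩
  comp {a b c} f g := ⟨f.1 ≫ g.1, by
    rw [op_comp, FunctorToTypes.map_comp_apply, g.2, f.2]⟩
  id_comp f := Subtype.ext (Category.id_comp f.1)
  comp_id f := Subtype.ext (Category.comp_id f.1)
  assoc f g h := Subtype.ext (Category.assoc f.1 g.1 h.1)

/-- The simplicial operator `φ̄ : [m] ⟶ [k_m]` associated to a chain of simplices,
given by `φ̄(i) = φ_i(k_i)`. -/
def barMap {X : SSet.{0}} {e : ℕ} (F : ComposableArrows (SimplexOf X) e) :
    (⦋e⦌ : SimplexCategory) ⟶ (F.obj (Fin.last e)).dim :=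
  SimplexCategory.Hom.mk
    { toFun := fun i => (F.map (homOfLE (Fin.le_last i))).1.toOrderHom (Fin.last _)
      monotone' := by
        intro i j hij
        dsimp only
        rw [show (homOfLE (Fin.le_last i) : i ⟶ Fin.last _) =
            homOfLE hij ≫ homOfLE (Fin.le_last j) from rfl, F.map_comp]
        exact (F.map (homOfLE (Fin.le_last j))).1.toOrderHom.monotone (Fin.le_last _) }

/-- The canonical map `τ_X : N(Δ ↓ X) ⟶ X` from the nerve of the category of
simplices of `X` to `X`. -/
def tau (X : SSet.{0}) : nerve (SimplexOf X) ⟶ X where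
  app m := ↾fun F => X.map (barMap F).op (F.obj (Fin.last _)).pt
  naturality := by
    intro m m' α
    apply ConcreteCategory.hom_ext
    intro F
    let Ψ : Fin (m'.unop.len + 1) ⥤ Fin (m.unop.len + 1) := (SimplexCategory.toCat.map α.unop).toFunctor
    show X.map (barMap (F.whiskerLeft Ψ)).op
        (((F.whiskerLeft Ψ).obj (Fin.last _)).pt)
      = X.map α (X.map (barMap F).op ((F.obj (Fin.last _)).pt))
    set ρ := F.map (homOfLE (Fin.le_last (Ψ.obj (Fin.last _)))) with hρ
    have key : barMap (F.whiskerLeft Ψ) ≫ ρ.1 = α.unop ≫ barMap F := by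
      apply SimplexCategory.Hom.ext
      apply OrderHom.ext
      funext i
      show ((F.whiskerLeft Ψ).map (homOfLE (Fin.le_last i)) ≫ ρ).1.toOrderHom
          (Fin.last _) = _
      have step : (F.whiskerLeft Ψ).map (homOfLE (Fin.le_last i)) ≫ ρ
          = F.map (homOfLE (Fin.le_last (Ψ.obj i))) := by
        show F.map (Ψ.map (homOfLE (Fin.le_last i))) ≫
            F.map (homOfLE (Fin.le_last (Ψ.obj (Fin.last _)))) = _
        rw [← F.map_comp]
        congr 1
      rw [step]
      rfl
    have hpt : ((F.whiskerLeft Ψ).obj (Fin.last _)).pt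
        = X.map (ρ.1.op) ((F.obj (Fin.last _)).pt) := ρ.2.symm
    rw [hpt]
    exact (FunctorToTypes.map_comp_apply X ρ.1.op (barMap (F.whiskerLeft Ψ)).op _).symm.trans
      ((congrArg (fun h => X.map h.op ((F.obj (Fin.last _)).pt)) key).trans
        (FunctorToTypes.map_comp_apply X (barMap F).op α _))

end Paper

namespace Paper

open CartesianMonoidalCategory HomotopicalAlgebra

open scoped SSet.modelCategoryQuillen

theorem hom_ext_apply {X Y : SSet.{0}} {f g : X ⟶ Y}
    (h : ∀ (m : SimplexCategoryᵒᵖ) (x : X.obj m), f.app m x = g.app m x) : f = g := by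
  apply NatTrans.ext
  funext m
  apply ConcreteCategory.hom_ext
  exact h m

theorem delta_one_ext {m : SimplexCategoryᵒᵖ} {s t : (Δ[1] : SSet.{0}).obj m}
    (h : ∀ j, (stdSimplex.objEquiv s).toOrderHom j = (stdSimplex.objEquiv t).toOrderHom j) :
    s = t := by
  apply stdSimplex.objEquiv.injective
  apply SimplexCategory.Hom.ext
  apply OrderHom.ext
  exact funext h

theorem ept_naturality {X Y : SSet.{0}} (f : X ⟶ Y) (k : Fin 2) :
    ept X k ≫ f ▷ Δ[1] = f ≫ ept Y k := rfl

theorem ept_naturality_assoc {X Y Z : SSet.{0}} (f : X ⟶ Y) (k : Fin 2) (g : Y ⊗ Δ[1] ⟶ Z) :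
    ept X k ≫ f ▷ Δ[1] ≫ g = f ≫ ept Y k ≫ g := rfl

theorem ept_fst (X : SSet.{0}) (k : Fin 2) : ept X k ≫ fst X Δ[1] = 𝟙 X := rfl

theorem ept_fst_assoc (X : SSet.{0}) (k : Fin 2) {Z : SSet.{0}} (g : X ⟶ Z) :
    ept X k ≫ fst X Δ[1] ≫ g = g := rfl

theorem Homotopy.whisker {X Y Z W : SSet.{0}} {f g : X ⟶ Y} (h : Homotopy f g) (a : Z ⟶ X)
    (b : Y ⟶ W) : Homotopy (a ≫ f ≫ b) (a ≫ g ≫ b) := by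
  obtain ⟨H, h0, h1⟩ := h
  refine ⟨a ▷ Δ[1] ≫ H ≫ b, ?_, ?_⟩
  · rw [ept_naturality_assoc, ← h0, Category.assoc]
  · rw [ept_naturality_assoc, ← h1, Category.assoc]

/-- A vertex inclusion `Δ[0] ⟶ Δ[1]` is anodyne. -/
theorem anodyneExtensions_cst (k : Fin 2) : anodyneExtensions.{0} (cst Δ[0] k) := by
  intro E B p hp
  have h : HasLiftingProperty (Λ[1, k] : SSet.Subcomplex.{0} _).ι p :=
    anodyneExtensions.horn_ι k p hp
  have e : toPt (Λ[1, k] : SSet.{0}) ≫ cst Δ[0] k = (Λ[1, k] : SSet.Subcomplex.{0} _).ι := by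
    apply hom_ext_apply
    rintro m ⟨s, hs⟩
    apply delta_one_ext
    intro j
    rw [SSet.mem_horn_iff] at hs
    show k = (stdSimplex.objEquiv s).toOrderHom j
    by_contra hne
    apply hs
    ext l
    have : l = k ∨ l = (stdSimplex.objEquiv s).toOrderHom j := by omega
    rcases this with rfl | rfl
    · simp
    · simp only [Set.mem_union, Set.mem_singleton_iff, Set.mem_univ, iff_true,
        Set.mem_range]
      exact Or.inl ⟨j, rfl⟩
  let v : Δ[0] ⟶ (Λ[1, k] : SSet.{0}) := Subcomplex.lift (cst Δ[0] k) (by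
    rintro m s ⟨t, rfl⟩
    show _ ∈ (Λ[1, k] : SSet.Subcomplex.{0} _).obj m
    rw [SSet.mem_horn_iff]
    intro h
    have h1 : (1 - k) ∈ (Set.univ : Set (Fin 2)) := trivial
    rw [← h] at h1
    rcases h1 with ⟨j, hj⟩ | h1
    · have : k = 1 - k := hj
      revert this; fin_cases k <;> simp
    · have : 1 - k = k := h1
      revert this; fin_cases k <;> simp)
  have ev : v ≫ (Λ[1, k] : SSet.Subcomplex.{0} _).ι = cst Δ[0] k := rfl
  refine ⟨fun {f g} sq => ?_⟩
  have sq' : CommSq (toPt _ ≫ f) (Λ[1, k] : SSet.Subcomplex.{0} _).ι p g := ⟨by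
    rw [Category.assoc, sq.w, ← e, Category.assoc]⟩
  refine ⟨⟨⟨sq'.lift, ?_, sq'.fac_right⟩⟩⟩
  rw [← ev, Category.assoc, sq'.fac_left, ← Category.assoc]
  rw [show v ≫ toPt (Λ[1, k] : SSet.{0}) = 𝟙 _ from stdSimplex.ext₀, Category.id_comp]

theorem exists_leibniz_lift {A B C D K L : SSet.{0}} (i : A ⟶ B) (j : C ⟶ D)
    (hij : anodyneExtensions
      (Functor.PushoutObjObj.ofHasPushout (curriedTensor SSet.{0}) i j).ι)
    (q : K ⟶ L) [hq : Fibration q]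
    (u : B ⊗ C ⟶ K) (v : A ⊗ D ⟶ K) (w : B ⊗ D ⟶ L)
    (huv : i ▷ C ≫ u = A ◁ j ≫ v) (hu : B ◁ j ≫ w = u ≫ q) (hv : i ▷ D ≫ w = v ≫ q) :
    ∃ H : B ⊗ D ⟶ K, B ◁ j ≫ H = u ∧ i ▷ D ≫ H = v ∧ H ≫ q = w := by
  set po := Functor.PushoutObjObj.ofHasPushout (curriedTensor SSet.{0}) i j with hpo
  have : HasLiftingProperty po.ι q := hij q (mem_fibrations q)
  have hl := po.inl_ι
  have hr := po.inr_ι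
  have sq : CommSq (po.isPushout.desc u v huv) po.ι q w := ⟨by
    apply po.hom_ext
    · rw [po.isPushout.inl_desc_assoc, reassoc_of% hl]
      exact hu.symm
    · rw [po.isPushout.inr_desc_assoc, reassoc_of% hr]
      exact hv.symm⟩
  refine ⟨sq.lift, ?_, ?_, sq.fac_right⟩
  · have := po.inl ≫= sq.fac_left
    rw [po.isPushout.inl_desc, reassoc_of% hl] at this
    exact this
  · have := po.inr ≫= sq.fac_left
    rw [po.isPushout.inr_desc, reassoc_of% hr] at this
    exact this

/-- The homotopy extension lifting property. -/
theorem exists_homotopy_lift {A B K L : SSet.{0}} (i : A ⟶ B) [Mono i] (q : K ⟶ L)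
    [Fibration q] (k : Fin 2) (c : B ⟶ K) (a : A ⊗ Δ[1] ⟶ K) (b : B ⊗ Δ[1] ⟶ L)
    (hca : ept A k ≫ a = i ≫ c) (hb : ept B k ≫ b = c ≫ q) (hab : i ▷ Δ[1] ≫ b = a ≫ q) :
    ∃ H : B ⊗ Δ[1] ⟶ K, ept B k ≫ H = c ∧ i ▷ Δ[1] ≫ H = a ∧ H ≫ q = b := by
  have e (X : SSet.{0}) : X ◁ cst Δ[0] k = fst X Δ[0] ≫ ept X k := rfl
  obtain ⟨H, h1, h2, h3⟩ := exists_leibniz_lift i (cst Δ[0] k)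
    (anodyneExtensions_pushoutObjObjι _ (anodyneExtensions_cst k)) q (fst B Δ[0] ≫ c) a b
    (by rw [e, Category.assoc, hca]; rfl)
    (by rw [e, Category.assoc, hb]; rfl) hab
  refine ⟨H, ?_, h2, h3⟩
  have := lift (𝟙 B) (toPt B) ≫= h1
  exact this

/-- The homotopy lifting property. -/
theorem exists_homotopy_lift' {B K L : SSet.{0}} (q : K ⟶ L)
    [Fibration q] (k : Fin 2) (c : B ⟶ K) (b : B ⊗ Δ[1] ⟶ L) (hb : ept B k ≫ b = c ≫ q) :
    ∃ H : B ⊗ Δ[1] ⟶ K, ept B k ≫ H = c ∧ H ≫ q = b := by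
  have : HasLiftingProperty (B ◁ cst Δ[0] k) q :=
    (anodyneExtensions_cst k).whiskerLeft B q (mem_fibrations q)
  have sq : CommSq (fst B Δ[0] ≫ c) (B ◁ cst Δ[0] k) q b := ⟨by
    rw [Category.assoc, ← hb]; rfl⟩
  exact ⟨sq.lift, lift (𝟙 B) (toPt B) ≫= sq.fac_left, sq.fac_right⟩

/-- The simplicial set `∂Δ[1]`, as a constant simplicial set on two vertices. -/
def twoPt : SSet.{0} := (Functor.const _).obj (Fin 2)

/-- The inclusion of the two vertices in `Δ[1]`. -/
def twoPtι : twoPt ⟶ Δ[1] where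
  app m := ↾fun k => SSet.stdSimplex.const 1 k m
  naturality := by
    intro m m' φ
    rfl

instance : Mono twoPtι := by
  rw [NatTrans.mono_iff_mono_app]
  intro m
  rw [mono_iff_injective]
  intro s t h
  have := congrArg (fun z => (stdSimplex.objEquiv z).toOrderHom 0) h
  exact this

/-- The map `X ⊗ ∂Δ[1] ⟶ Y` given by two maps `X ⟶ Y`. -/
def twoPtDesc {X Y : SSet.{0}} (f : Fin 2 → (X ⟶ Y)) : X ⊗ twoPt ⟶ Y where
  app m := ↾fun z => (f z.2).app m z.1
  naturality := by
    intro m m' φ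
    apply ConcreteCategory.hom_ext
    intro z
    exact ConcreteCategory.congr_hom ((f z.2).naturality φ) z.1

/-- Two extensions along an anodyne map `j` of homotopic maps are homotopic, by a
homotopy extending the given one. -/
theorem exists_homotopy_of_anodyne {P A K : SSet.{0}} (j : P ⟶ A) (hj : anodyneExtensions j)
    [Fibration (toPt K)] (a : Fin 2 → (A ⟶ K)) (h : P ⊗ Δ[1] ⟶ K)
    (hh : ∀ k, ept P k ≫ h = j ≫ a k) :
    ∃ H : A ⊗ Δ[1] ⟶ K, (∀ k, ept A k ≫ H = a k) ∧ j ▷ Δ[1] ≫ H = h := by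
  obtain ⟨H, h1, h2, -⟩ := exists_leibniz_lift j twoPtι
    (anodyneExtensions_pushoutObjObjι' _ hj) (toPt K) (twoPtDesc a) h (toPt _)
    (by
      apply hom_ext_apply
      rintro m ⟨x, k⟩
      have := NatTrans.congr_app (hh k) m
      exact (ConcreteCategory.congr_hom this x).symm)
    stdSimplex.ext₀ stdSimplex.ext₀
  refine ⟨H, fun k => ?_, h2⟩
  apply hom_ext_apply
  intro m x
  have := NatTrans.congr_app h1 m
  exact ConcreteCategory.congr_hom this (show (A ⊗ twoPt).obj m from (x, k))

/-- Moving the base of a lifting problem along a homotopy. -/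
theorem exists_lift_of_homotopy {A B K L : SSet.{0}} (i : A ⟶ B) [Mono i] (q : K ⟶ L)
    [Fibration q] {b b' : B ⟶ L} (h : Homotopy b b')
    (hb' : ∀ a : A ⟶ K, a ≫ q = i ≫ b' → ∃ l : B ⟶ K, i ≫ l = a ∧ l ≫ q = b')
    (a : A ⟶ K) (ha : a ≫ q = i ≫ b) : ∃ l : B ⟶ K, i ≫ l = a ∧ l ≫ q = b := by
  obtain ⟨H, h0, h1⟩ := h
  obtain ⟨G, g0, g2⟩ := exists_homotopy_lift' q 0 a (i ▷ Δ[1] ≫ H)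
    (by rw [ept_naturality_assoc, h0, ha])
  obtain ⟨l, l1, l2⟩ := hb' (ept A 1 ≫ G) (by
    rw [Category.assoc, g2, ept_naturality_assoc, h1])
  obtain ⟨M, m1, m2, m3⟩ := exists_homotopy_lift i q 1 l G H l1.symm (by rw [h1, l2]) g2.symm
  exact ⟨ept B 0 ≫ M, by rw [← ept_naturality_assoc, m2, g0], by rw [Category.assoc, m3, h0]⟩

end Paper

namespace Paper

open CartesianMonoidalCategory HomotopicalAlgebra

open scoped SSet.modelCategoryQuillen

theorem toPt_comp {X Y : SSet.{0}} (f : X ⟶ Y) : f ≫ toPt Y = toPt X := rfl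

/-- Extension of a map to a Kan complex along a monomorphism whose source receives an
anodyne map from a contractible simplicial set. -/
theorem exists_extension_of_contractible {P A B K : SSet.{0}} (j : P ⟶ A)
    (hj : anodyneExtensions j) (i : A ⟶ B) [Mono i] (p₀ : Δ[0] ⟶ P)
    (hP : Homotopy (𝟙 P) (toPt P ≫ p₀)) [Fibration (toPt K)] (a : A ⟶ K) :
    ∃ l : B ⟶ K, i ≫ l = a := by
  obtain ⟨h, h0, h1⟩ := hP
  obtain ⟨H, hH, -⟩ := exists_homotopy_of_anodyne j hj ![a, toPt A ≫ p₀ ≫ j ≫ a]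
    (h ≫ j ≫ a) (by
      intro k
      fin_cases k
      · show ept P 0 ≫ h ≫ j ≫ a = j ≫ a
        rw [← Category.assoc, h0, Category.id_comp]
      · show ept P 1 ≫ h ≫ j ≫ a = j ≫ toPt A ≫ p₀ ≫ j ≫ a
        rw [← Category.assoc, h1, Category.assoc, ← Category.assoc j, toPt_comp])
  obtain ⟨G, -, g2, -⟩ := exists_homotopy_lift i (toPt K) 1 (toPt B ≫ p₀ ≫ j ≫ a) H (toPt _)
    (hH 1) rfl rfl
  exact ⟨ept B 0 ≫ G, by rw [← ept_naturality_assoc, g2]; exact hH 0⟩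

theorem anodyneExtensions_of_contractible {P A B : SSet.{0}} (j : P ⟶ A)
    (hj : anodyneExtensions j) (i : A ⟶ B) [Mono i] (p₀ : Δ[0] ⟶ P)
    (hP : Homotopy (𝟙 P) (toPt P ≫ p₀)) (b₀ : Δ[0] ⟶ B)
    (hB : Relation.ReflTransGen Homotopy (𝟙 B) (toPt B ≫ b₀)) : anodyneExtensions i := by
  intro K L q hq
  have : Fibration q := (fibration_iff q).2 hq
  suffices ∀ (b : B ⟶ L) (a : A ⟶ K), a ≫ q = i ≫ b → ∃ l : B ⟶ K, i ≫ l = a ∧ l ≫ q = b by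
    refine ⟨fun {a b} sq => ?_⟩
    obtain ⟨l, h1, h2⟩ := this b a sq.w
    exact ⟨⟨⟨l, h1, h2⟩⟩⟩
  intro b
  suffices ∀ a : A ⟶ K, a ≫ q = i ≫ (𝟙 B) ≫ b →
      ∃ l : B ⟶ K, i ≫ l = a ∧ l ≫ q = (𝟙 B) ≫ b by
    simpa using this
  generalize hf : 𝟙 B = f at hB ⊢
  clear hf
  induction hB using Relation.ReflTransGen.head_induction_on with
  | head h _ ih =>
    refine exists_lift_of_homotopy i q ?_ ih
    simpa using h.whisker (𝟙 B) b
  | refl =>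
    intro a ha
    have hpb := IsPullback.of_hasPullback q (b₀ ≫ b)
    have : Fibration (toPt (pullback q (b₀ ≫ b))) := by
      rw [show toPt (pullback q (b₀ ≫ b)) = pullback.snd q (b₀ ≫ b) from stdSimplex.ext₀]
      rw [fibration_iff]
      exact MorphismProperty.of_isPullback (P := modelCategoryQuillen.J.rlp) hpb hq
    obtain ⟨l, hl⟩ := exists_extension_of_contractible j hj i p₀ hP
      (hpb.lift a (toPt A) (by rw [ha, Category.assoc, ← Category.assoc i, toPt_comp]))
    refine ⟨l ≫ pullback.fst _ _, ?_, ?_⟩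
    · rw [← Category.assoc, hl, hpb.lift_fst]
    · rw [Category.assoc, hpb.w, ← Category.assoc]
      rw [show l ≫ pullback.snd q (b₀ ≫ b) = toPt B from stdSimplex.ext₀, Category.assoc]

end Paper

namespace Paper

open CartesianMonoidalCategory

/-- The functor between categories of simplices induced by a map of simplicial sets. -/
def simplexMap {X Y : SSet.{0}} (f : X ⟶ Y) : SimplexOf X ⥤ SimplexOf Y where
  obj a := ⟨a.dim, f.app _ a.pt⟩
  map {a b} φ := ⟨φ.1, by
    have := ConcreteCategory.congr_hom (f.naturality φ.1.op) b.pt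
    exact this.symm.trans (congrArg (f.app _) φ.2)⟩

/-- The functor sending a simplicial set to the nerve of its category of simplices. -/
def nerveSimplex : SSet.{0} ⥤ SSet.{0} where
  obj X := nerve (SimplexOf X)
  map f := nerveMap (simplexMap f)

theorem tau_naturality {X Y : SSet.{0}} (f : X ⟶ Y) :
    nerveSimplex.map f ≫ tau Y = tau X ≫ f := by
  apply hom_ext_apply
  intro m F
  exact (ConcreteCategory.congr_hom (f.naturality (barMap (show ComposableArrows _ _ from F)).op)
    ((show ComposableArrows _ _ from F).obj (Fin.last _)).pt).symm

theorem tau_naturality_apply {X Y : SSet.{0}} (f : X ⟶ Y) {m : SimplexCategoryᵒᵖ}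
    (d : (nerveSimplex.obj X).obj m) :
    (tau Y).app m ((nerveSimplex.map f).app m d) = f.app m ((tau X).app m d) :=
  ConcreteCategory.congr_hom (NatTrans.congr_app (tau_naturality f) m) d

/-- The simplices of the mapping cylinder of `tau X`. -/
structure CylSimplex (X : SSet.{0}) (m : SimplexCategoryᵒᵖ) where
  /-- the image in `X` -/
  pt : X.obj m
  /-- the cylinder coordinate -/
  par : (Δ[1] : SSet.{0}).obj m
  /-- the lift to the nerve away from the end `1` of the cylinder -/
  lft : par ≠ stdSimplex.const 1 1 m → (nerveSimplex.obj X).obj m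
  tau_lft : ∀ h, (tau X).app m (lft h) = pt

namespace CylSimplex

theorem ext' {X : SSet.{0}} {m : SimplexCategoryᵒᵖ} {z w : CylSimplex X m}
    (h₁ : z.pt = w.pt) (h₂ : z.par = w.par) (h₃ : ∀ h h', z.lft h = w.lft h') : z = w := by
  obtain ⟨x, s, d, hd⟩ := z
  obtain ⟨x', s', d', hd'⟩ := w
  obtain rfl : x = x' := h₁
  obtain rfl : s = s' := h₂
  obtain rfl : d = d' := funext fun h => h₃ h h
  rfl

/-- The action of a simplicial operator. -/
def restrict {X : SSet.{0}} {m m' : SimplexCategoryᵒᵖ} (α : m ⟶ m') (z : CylSimplex X m) :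
    CylSimplex X m' where
  pt := X.map α z.pt
  par := (Δ[1] : SSet.{0}).map α z.par
  lft h := (nerveSimplex.obj X).map α (z.lft fun e => h (by rw [e]; rfl))
  tau_lft h := by
    rw [← z.tau_lft]
    exact ConcreteCategory.congr_hom ((tau X).naturality α) _

/-- Functoriality of cylinder simplices. -/
def map {X Y : SSet.{0}} (f : X ⟶ Y) {m : SimplexCategoryᵒᵖ} (z : CylSimplex X m) :
    CylSimplex Y m where
  pt := f.app m z.pt
  par := z.par
  lft h := (nerveSimplex.map f).app m (z.lft h)
  tau_lft h := by rw [tau_naturality_apply, z.tau_lft]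

end CylSimplex

/-- The mapping cylinder of `tau X`. -/
def cylObj (X : SSet.{0}) : SSet.{0} where
  obj m := CylSimplex X m
  map α := ↾fun z => z.restrict α
  map_id m := by
    apply ConcreteCategory.hom_ext
    intro z
    apply CylSimplex.ext'
    · exact ConcreteCategory.congr_hom (X.map_id m) z.pt
    · exact ConcreteCategory.congr_hom ((Δ[1] : SSet.{0}).map_id m) z.par
    · intro h h'
      exact ConcreteCategory.congr_hom ((nerveSimplex.obj X).map_id m) _
  map_comp α β := by
    apply ConcreteCategory.hom_ext
    intro z
    apply CylSimplex.ext'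
    · exact ConcreteCategory.congr_hom (X.map_comp α β) z.pt
    · rfl
    · intro h h'
      exact ConcreteCategory.congr_hom ((nerveSimplex.obj X).map_comp α β) _

/-- The mapping cylinder of `tau`, as a functor. -/
def cyl : SSet.{0} ⥤ SSet.{0} where
  obj := cylObj
  map f :=
    { app m := ↾fun z => CylSimplex.map f z
      naturality := by
        intro m m' α
        apply ConcreteCategory.hom_ext
        intro z
        apply CylSimplex.ext'
        · exact ConcreteCategory.congr_hom (f.naturality α) z.pt
        · rfl
        · intro h h'
          exact ConcreteCategory.congr_hom ((nerveSimplex.map f).naturality α) _ }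

/-- The inclusion of the nerve at the end `0` of the mapping cylinder. -/
def cylι : nerveSimplex ⟶ cyl where
  app X :=
    { app m := ↾fun d => CylSimplex.mk ((tau X).app m d) (stdSimplex.const 1 0 m) (fun _ => d)
        (fun _ => rfl)
      naturality := by
        intro m m' α
        apply ConcreteCategory.hom_ext
        intro d
        apply CylSimplex.ext'
        · exact ConcreteCategory.congr_hom ((tau X).naturality α) d
        · rfl
        · intro h h'
          rfl }
  naturality X Y f := by
    apply hom_ext_apply
    intro m d
    apply CylSimplex.ext'
    · exact tau_naturality_apply f d
    · rfl
    · intro h h'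
      rfl

/-- The inclusion of `X` at the end `1` of the mapping cylinder. -/
def cylEnd (X : SSet.{0}) : X ⟶ cyl.obj X where
  app m := ↾fun x => CylSimplex.mk x (stdSimplex.const 1 1 m) (fun h => (h rfl).elim)
    (fun h => (h rfl).elim)
  naturality := by
    intro m m' α
    apply ConcreteCategory.hom_ext
    intro d
    apply CylSimplex.ext'
    · rfl
    · rfl
    · intro h h'
      exact (h rfl).elim

/-- The retraction of the mapping cylinder on `X`. -/
def cylRet (X : SSet.{0}) : cyl.obj X ⟶ X where
  app m := ↾fun z => CylSimplex.pt z

theorem cylEnd_ret (X : SSet.{0}) : cylEnd X ≫ cylRet X = 𝟙 X := rfl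

theorem cylι_ret (X : SSet.{0}) : cylι.app X ≫ cylRet X = tau X := rfl

theorem const_zero_ne (m : SimplexCategoryᵒᵖ) :
    stdSimplex.const.{0} 1 0 m ≠ stdSimplex.const 1 1 m := by
  intro h
  have : (0 : Fin 2) = 1 := congrArg (fun z => (stdSimplex.objEquiv z).toOrderHom 0) h
  simp at this

/-- The homotopy from `cylι` to `tau` followed by `cylEnd`. -/
def cylHtpy (X : SSet.{0}) : nerveSimplex.obj X ⊗ Δ[1] ⟶ cyl.obj X where
  app m := ↾fun z => CylSimplex.mk ((tau X).app m z.1) z.2 (fun _ => z.1) (fun _ => rfl)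
  naturality := by
    intro m m' α
    apply ConcreteCategory.hom_ext
    intro d
    apply CylSimplex.ext'
    · exact ConcreteCategory.congr_hom ((tau X).naturality α) d.1
    · rfl
    · intro h h'
      rfl

theorem homotopy_cylι (X : SSet.{0}) : Homotopy (cylι.app X) (tau X ≫ cylEnd X) := by
  refine ⟨cylHtpy X, rfl, ?_⟩
  apply hom_ext_apply
  intro m z
  apply CylSimplex.ext'
  · rfl
  · rfl
  · intro h h'
    exact (h rfl).elim

/-- The pointwise maximum of two simplices of `Δ[1]`. -/
def supOne {m : SimplexCategoryᵒᵖ} (s t : (Δ[1] : SSet.{0}).obj m) : (Δ[1] : SSet.{0}).obj m :=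
  stdSimplex.objEquiv.symm (SimplexCategory.Hom.mk
    ((stdSimplex.objEquiv s).toOrderHom ⊔ (stdSimplex.objEquiv t).toOrderHom))

theorem supOne_one_left {m : SimplexCategoryᵒᵖ} (t : (Δ[1] : SSet.{0}).obj m) :
    supOne (stdSimplex.const 1 1 m) t = stdSimplex.const 1 1 m := by
  apply delta_one_ext
  intro j
  show max (1 : Fin 2) _ = 1
  exact max_eq_left (Fin.le_last _)

theorem supOne_one_right {m : SimplexCategoryᵒᵖ} (s : (Δ[1] : SSet.{0}).obj m) :
    supOne s (stdSimplex.const 1 1 m) = stdSimplex.const 1 1 m := by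
  apply delta_one_ext
  intro j
  show max _ (1 : Fin 2) = 1
  exact max_eq_right (Fin.le_last _)

theorem supOne_zero_right {m : SimplexCategoryᵒᵖ} (s : (Δ[1] : SSet.{0}).obj m) :
    supOne s (stdSimplex.const 1 0 m) = s := by
  apply delta_one_ext
  intro j
  show max _ (0 : Fin 2) = _
  exact max_eq_left (Fin.zero_le _)

/-- The deformation of the mapping cylinder onto its end `1`. -/
def cylDef (X : SSet.{0}) : cyl.obj X ⊗ Δ[1] ⟶ cyl.obj X where
  app m := ↾fun z => CylSimplex.mk (CylSimplex.pt z.1) (supOne (CylSimplex.par z.1) z.2)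
    (fun h => CylSimplex.lft z.1 fun e => h (by rw [e, supOne_one_left]))
    (fun h => CylSimplex.tau_lft z.1 _)
  naturality := by
    intro m m' α
    apply ConcreteCategory.hom_ext
    intro d
    apply CylSimplex.ext'
    · rfl
    · rfl
    · intro h h'
      rfl

theorem homotopy_cylDef (X : SSet.{0}) : Homotopy (𝟙 (cyl.obj X)) (cylRet X ≫ cylEnd X) := by
  refine ⟨cylDef X, ?_, ?_⟩
  · apply hom_ext_apply
    intro m z
    apply CylSimplex.ext'
    · rfl
    · exact supOne_zero_right _
    · intro h h'
      rfl
  · apply hom_ext_apply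
    intro m z
    apply CylSimplex.ext'
    · rfl
    · exact supOne_one_right _
    · intro h h'
      exact (h' rfl).elim

theorem cylι_lft {X : SSet.{0}} {m : SimplexCategoryᵒᵖ} (d : (nerveSimplex.obj X).obj m) :
    CylSimplex.lft ((cylι.app X).app m d) (const_zero_ne m) = d := rfl

theorem cylι_injective (X : SSet.{0}) (m : SimplexCategoryᵒᵖ) :
    Function.Injective ((cylι.app X).app m) := by
  intro d d' h
  rw [← cylι_lft d, ← cylι_lft d']
  simp only [h]

theorem cyl_map_injective {X Y : SSet.{0}} (f : X ⟶ Y) (m : SimplexCategoryᵒᵖ)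
    (hf : Function.Injective (f.app m)) (hf' : Function.Injective ((nerveSimplex.map f).app m)) :
    Function.Injective ((cyl.map f).app m) := by
  intro z w h
  have h₁ : f.app m (CylSimplex.pt z) = f.app m (CylSimplex.pt w) :=
    congrArg (CylSimplex.pt (X := Y)) h
  have h₂ : CylSimplex.par z = CylSimplex.par w :=
    congrArg (CylSimplex.par (X := Y)) h
  obtain ⟨x, s, d, hd⟩ := z
  obtain ⟨x', s', d', hd'⟩ := w
  obtain rfl : x = x' := hf h₁
  obtain rfl : s = s' := h₂
  have h₃ : d = d' := by
    funext k
    apply hf'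
    have : (CylSimplex.mk (f.app m x) s (fun k => (nerveSimplex.map f).app m (d k)) _ :
      CylSimplex Y m) = CylSimplex.mk (f.app m x) s (fun k => (nerveSimplex.map f).app m (d' k)) _
      := h
    injection this with _ _ h
    exact congrFun h k
  subst h₃
  rfl

instance (X : SSet.{0}) : Mono (cylι.app X) := by
  rw [NatTrans.mono_iff_mono_app]
  intro m
  rw [mono_iff_injective]
  exact cylι_injective X m

/-- The functor sending a simplex to its dimension. -/
def simplexDim (X : SSet.{0}) : SimplexOf X ⥤ SimplexCategory where
  obj a := a.dim
  map φ := φ.1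

/-- A functor to the category of simplices, from its dimensions and a compatible family of
simplices. -/
def simplexFunctor {X : SSet.{0}} {J : Type} [Category.{0} J] (c : J ⥤ SimplexCategory)
    (p : ∀ j, X.obj (Opposite.op (c.obj j)))
    (h : ∀ {i j : J} (g : i ⟶ j), X.map (c.map g).op (p j) = p i) : J ⥤ SimplexOf X where
  obj j := ⟨c.obj j, p j⟩
  map g := ⟨c.map g, h g⟩
  map_id j := Subtype.ext (c.map_id j)
  map_comp g g' := Subtype.ext (c.map_comp g g')

theorem simplexFunctor_ext {X : SSet.{0}} {J : Type} [Category.{0} J] {F G : J ⥤ SimplexOf X}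
    (h : F ⋙ simplexDim X = G ⋙ simplexDim X) (hp : ∀ j, F.obj j = G.obj j) : F = G := by
  have hF : F = simplexFunctor (F ⋙ simplexDim X) (fun j => (F.obj j).pt)
    (fun g => (F.map g).2) := rfl
  have hG : G = simplexFunctor (G ⋙ simplexDim X) (fun j => (G.obj j).pt)
    (fun g => (G.map g).2) := rfl
  have hq : ∀ j, HEq (F.obj j).pt (G.obj j).pt := fun j => by rw [hp j]
  have key : ∀ (c : J ⥤ SimplexCategory) (hc : c = G ⋙ simplexDim X)
      (p : ∀ j, X.obj (Opposite.op (c.obj j)))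
      (h : ∀ {i j : J} (g : i ⟶ j), X.map (c.map g).op (p j) = p i)
      (_ : ∀ j, HEq (p j) (G.obj j).pt), simplexFunctor c p h = G := by
    rintro c rfl p h hp
    obtain rfl : p = fun j => (G.obj j).pt := funext fun j => eq_of_heq (hp j)
    rfl
  exact hF.trans (key _ h _ _ hq)

theorem nerveSimplex_map_injective {X Y : SSet.{0}} (f : X ⟶ Y) [Mono f]
    (m : SimplexCategoryᵒᵖ) : Function.Injective ((nerveSimplex.map f).app m) := by
  have hf (k) : Function.Injective (f.app k) := by
    rw [← mono_iff_injective]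
    exact (NatTrans.mono_iff_mono_app f).1 inferInstance k
  have hf' : Function.Injective (simplexMap f).obj := by
    rintro ⟨a, x⟩ ⟨b, y⟩ h
    obtain rfl : a = b := congrArg SimplexOf.dim h
    rw [SimplexOf.mk.injEq]
    refine ⟨rfl, heq_of_eq (hf _ ?_)⟩
    injection h
  intro (F : ComposableArrows _ _) (G : ComposableArrows _ _) h
  have h' : F ⋙ simplexMap f = G ⋙ simplexMap f := h
  exact simplexFunctor_ext (congrArg (fun H => H ⋙ simplexDim Y) h')
    fun j => hf' (congrArg (fun H => H.obj j) h')

/-- The Leibniz map from the pushout to the mapping cylinder is a monomorphism. -/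
theorem mono_cyl_leibniz {X Y P : SSet.{0}} (f : X ⟶ Y) [Mono f] {r : nerveSimplex.obj Y ⟶ P}
    {b : cyl.obj X ⟶ P} (h : IsPushout (nerveSimplex.map f) (cylι.app X) r b)
    (k : P ⟶ cyl.obj Y) (hr : r ≫ k = cylι.app Y) (hb : b ≫ k = cyl.map f) : Mono k := by
  rw [NatTrans.mono_iff_mono_app]
  intro m
  have hf : Function.Injective (f.app m) := by
    rw [← mono_iff_injective]
    exact (NatTrans.mono_iff_mono_app f).1 inferInstance m
  have hD := nerveSimplex_map_injective f m
  have : Mono ((cylι.app Y).app m) := by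
    rw [mono_iff_injective]
    exact cylι_injective Y m
  refine Types.mono_of_isPushout_of_isPullback (h.map ((evaluation _ _).obj m))
    (r' := (cylι.app Y).app m) (b' := (cyl.map f).app m) ?_
    (NatTrans.congr_app hr m) (NatTrans.congr_app hb m) ?_
  · rw [Types.isPullback_iff]
    refine ⟨NatTrans.congr_app (cylι.naturality f) m, fun d d' hd => hD hd.1, ?_⟩
    intro d z hz
    have h₁ : (tau Y).app m d = f.app m (CylSimplex.pt z) :=
      congrArg (CylSimplex.pt (X := Y)) hz
    have h₂ : stdSimplex.const 1 0 m = CylSimplex.par z := congrArg (CylSimplex.par (X := Y)) hz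
    obtain ⟨x, s, e, he⟩ := z
    obtain rfl : stdSimplex.const 1 0 m = s := h₂
    have h₃ : d = (nerveSimplex.map f).app m (e (const_zero_ne m)) := by
      rw [← cylι_lft d]
      simp only [hz]
      rfl
    refine ⟨e (const_zero_ne m), h₃.symm, ?_⟩
    apply CylSimplex.ext'
    · exact he _
    · rfl
    · intro h h'
      rfl
  · intro z w _ _ hzw
    exact cyl_map_injective f m hf hD hzw

end Paper

namespace Paper

/-- An endofunctor of simplicial sets such that every simplex of a value admits a universal
representative over a standard simplex. -/
def HasUniversalReps (G : SSet.{0} ⥤ SSet.{0}) : Prop :=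
  ∀ (X : SSet.{0}) (m : SimplexCategoryᵒᵖ) (z : (G.obj X).obj m),
    ∃ (n : SimplexCategory) (x : stdSimplex.obj n ⟶ X) (ζ : (G.obj (stdSimplex.obj n)).obj m),
      (G.map x).app m ζ = z ∧
        ∀ (n' : SimplexCategory) (x' : stdSimplex.obj n' ⟶ X)
          (ζ' : (G.obj (stdSimplex.obj n')).obj m), (G.map x').app m ζ' = z →
          ∃ φ : stdSimplex.obj n ⟶ stdSimplex.obj n', φ ≫ x' = x ∧ (G.map φ).app m ζ = ζ'

namespace HasUniversalReps

variable {G : SSet.{0} ⥤ SSet.{0}}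

theorem hom_ext (hG : HasUniversalReps G) {X Z : SSet.{0}} {f g : G.obj X ⟶ Z}
    (h : ∀ (n : SimplexCategory) (x : stdSimplex.obj n ⟶ X), G.map x ≫ f = G.map x ≫ g) :
    f = g := by
  apply hom_ext_apply
  intro m z
  obtain ⟨n, x, ζ, rfl, -⟩ := hG X m z
  exact ConcreteCategory.congr_hom (NatTrans.congr_app (h n x) m) ζ

theorem exists_desc (hG : HasUniversalReps G) {X Z : SSet.{0}}
    (c : ∀ (n : SimplexCategory) (_ : stdSimplex.obj n ⟶ X), G.obj (stdSimplex.obj n) ⟶ Z)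
    (hc : ∀ (n n' : SimplexCategory) (φ : stdSimplex.obj n ⟶ stdSimplex.obj n')
      (x : stdSimplex.obj n' ⟶ X), c n (φ ≫ x) = G.map φ ≫ c n' x) :
    ∃ f : G.obj X ⟶ Z, ∀ n x, G.map x ≫ f = c n x := by
  have key : ∀ (m : SimplexCategoryᵒᵖ) (n n' : SimplexCategory) (x : stdSimplex.obj n ⟶ X)
      (x' : stdSimplex.obj n' ⟶ X) (ζ : (G.obj (stdSimplex.obj n)).obj m)
      (ζ' : (G.obj (stdSimplex.obj n')).obj m), (G.map x).app m ζ = (G.map x').app m ζ' →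
      (c n x).app m ζ = (c n' x').app m ζ' := by
    intro m n n' x x' ζ ζ' h
    obtain ⟨k, y, ξ, -, hξ⟩ := hG X m ((G.map x).app m ζ)
    obtain ⟨φ, hφ, hφ'⟩ := hξ n x ζ rfl
    obtain ⟨ψ, hψ, hψ'⟩ := hξ n' x' ζ' h.symm
    have e₁ := hc _ _ φ x
    have e₂ := hc _ _ ψ x'
    rw [hφ] at e₁
    rw [hψ] at e₂
    rw [← hφ', ← hψ']
    exact ConcreteCategory.congr_hom (NatTrans.congr_app (e₁.symm.trans e₂) m) ξ
  choose n x ζ hζ _ using hG X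
  refine ⟨{ app m := ↾fun z => (c (n m z) (x m z)).app m (ζ m z), naturality := ?_ }, ?_⟩
  · intro m m' α
    apply ConcreteCategory.hom_ext
    intro z
    refine Eq.trans ?_ (ConcreteCategory.congr_hom
      ((c (n m z) (x m z)).naturality α) (ζ m z))
    refine key m' _ _ _ _ _ _ ?_
    rw [hζ]
    refine Eq.trans ?_ (ConcreteCategory.congr_hom ((G.map (x m z)).naturality α) (ζ m z)).symm
    exact (congrArg ((G.obj X).map α) (hζ m z)).symm
  · intro k y
    apply hom_ext_apply
    intro m ξ
    exact key m _ _ _ _ _ _ (hζ _ _)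

end HasUniversalReps

theorem hasUniversalReps_nerveSimplex : HasUniversalReps nerveSimplex := by
  intro X m (F : ComposableArrows (SimplexOf X) m.unop.len)
  let a := F.obj (Fin.last _)
  let ζ : ComposableArrows (SimplexOf (stdSimplex.{0}.obj a.dim)) m.unop.len :=
    simplexFunctor (F ⋙ simplexDim X)
      (fun j => stdSimplex.objEquiv.symm (F.map (homOfLE (Fin.le_last j))).1)
      (fun {i j} g => by
        have := congrArg (fun k => (stdSimplex.objEquiv.{0} (n := a.dim)
          (m := Opposite.op (F.obj i).dim)).symm (Subtype.val k))
          (F.map_comp g (homOfLE (Fin.le_last j)))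
        exact this.symm)
  refine ⟨a.dim, SSet.yonedaEquiv.symm a.pt, ζ, ?_, ?_⟩
  · change ζ ⋙ simplexMap _ = F
    refine simplexFunctor_ext rfl fun j => ?_
    exact congrArg (SimplexOf.mk _) (F.map (homOfLE (Fin.le_last j))).2
  · intro n' x' (ζ' : ComposableArrows _ _) h
    obtain rfl : ζ' ⋙ simplexMap x' = F := h
    refine ⟨SSet.yonedaEquiv.symm (ζ'.obj (Fin.last _)).pt, ?_, ?_⟩
    · exact SSet.yonedaEquiv_symm_comp _ _
    · change ζ ⋙ simplexMap _ = ζ'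
      refine simplexFunctor_ext rfl fun j => ?_
      exact congrArg (SimplexOf.mk _) (ζ'.map (homOfLE (Fin.le_last j))).2

theorem hasUniversalReps_cyl : HasUniversalReps cyl := by
  intro X m (z : CylSimplex X m)
  by_cases hz : z.par = stdSimplex.const 1 1 m
  · have aux (n : SimplexCategory) (x : stdSimplex.obj n ⟶ X) (ζ : CylSimplex _ m)
        (h : (cyl.map x).app m ζ = z) : ζ.par = stdSimplex.const 1 1 m ∧
          x.app m ζ.pt = z.pt :=
      ⟨(congrArg (CylSimplex.par (X := X)) h).trans hz, congrArg (CylSimplex.pt (X := X)) h⟩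
    refine ⟨m.unop, SSet.yonedaEquiv.symm z.pt,
      (cylEnd _).app m (stdSimplex.objEquiv.symm (𝟙 m.unop)), ?_, ?_⟩
    · apply CylSimplex.ext'
      · exact ConcreteCategory.congr_hom (X.map_id m) z.pt
      · exact hz.symm
      · intro h h'
        exact (h' hz).elim
    · intro n' x' (ζ' : CylSimplex _ m) h
      obtain ⟨h₁, h₂⟩ := aux _ _ _ h
      refine ⟨SSet.yonedaEquiv.symm ζ'.pt, ?_, ?_⟩
      · rw [yonedaEquiv_symm_comp, h₂]
      · apply CylSimplex.ext'
        · exact ConcreteCategory.congr_hom ((stdSimplex.{0}.obj n').map_id m) ζ'.pt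
        · exact h₁.symm
        · intro h h'
          exact (h' h₁).elim
  · obtain ⟨n, x, ζ, hζ, huniv⟩ := hasUniversalReps_nerveSimplex X m (z.lft hz)
    refine ⟨n, x, CylSimplex.mk ((tau _).app m ζ) z.par (fun _ => ζ) (fun _ => rfl), ?_, ?_⟩
    · apply CylSimplex.ext'
      · refine (tau_naturality_apply x ζ).symm.trans ?_
        rw [hζ, z.tau_lft]
      · rfl
      · intro h h'
        exact hζ
    · intro n' x' (ζ' : CylSimplex _ m) h
      have h : CylSimplex.map x' ζ' = z := h
      subst h
      obtain ⟨φ, hφ, hφ'⟩ := huniv n' x' (ζ'.lft hz) rfl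
      refine ⟨φ, hφ, ?_⟩
      apply CylSimplex.ext'
      · refine (tau_naturality_apply φ ζ).symm.trans ?_
        rw [hφ']
        exact ζ'.tau_lft hz
      · rfl
      · intro h h'
        exact hφ'

/-- The functor sending `X` to the arrow `cylι.app X`. -/
def cylArrow : SSet.{0} ⥤ Arrow SSet.{0} where
  obj X := Arrow.mk (cylι.app X)
  map f := Arrow.homMk (nerveSimplex.map f) (cyl.map f) (cylι.naturality f)
  map_id X := by
    ext1
    · exact nerveSimplex.map_id X
    · exact cyl.map_id X
  map_comp f g := by
    ext1
    · exact nerveSimplex.map_comp f g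
    · exact cyl.map_comp f g

theorem cylArrow_hom_ext {X : SSet.{0}} {q : Arrow SSet.{0}} {f g : cylArrow.obj X ⟶ q}
    (h : ∀ (n : SimplexCategory) (x : stdSimplex.obj n ⟶ X),
      cylArrow.map x ≫ f = cylArrow.map x ≫ g) : f = g := by
  ext1
  · exact hasUniversalReps_nerveSimplex.hom_ext fun n x => congrArg CommaMorphism.left (h n x)
  · exact hasUniversalReps_cyl.hom_ext fun n x => congrArg CommaMorphism.right (h n x)

theorem exists_cylArrow_desc {X : SSet.{0}} {q : Arrow SSet.{0}}
    (c : ∀ (n : SimplexCategory) (_ : stdSimplex.obj n ⟶ X), cylArrow.obj (stdSimplex.obj n) ⟶ q)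
    (hc : ∀ (n n' : SimplexCategory) (φ : stdSimplex.obj n ⟶ stdSimplex.obj n')
      (x : stdSimplex.obj n' ⟶ X), c n (φ ≫ x) = cylArrow.map φ ≫ c n' x) :
    ∃ f : cylArrow.obj X ⟶ q, ∀ n x, cylArrow.map x ≫ f = c n x := by
  obtain ⟨l, hl⟩ := hasUniversalReps_nerveSimplex.exists_desc (fun n x => (c n x).left)
    (fun n n' φ x => congrArg CommaMorphism.left (hc n n' φ x))
  obtain ⟨r, hr⟩ := hasUniversalReps_cyl.exists_desc (fun n x => (c n x).right)
    (fun n n' φ x => congrArg CommaMorphism.right (hc n n' φ x))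
  refine ⟨Arrow.homMk l r ?_, fun n x => ?_⟩
  · refine hasUniversalReps_nerveSimplex.hom_ext fun n x => ?_
    have e := cylι.naturality x
    show nerveSimplex.map x ≫ l ≫ q.hom = nerveSimplex.map x ≫ cylι.app X ≫ r
    rw [reassoc_of% hl, reassoc_of% e, hr]
    exact Arrow.w (c n x)
  · ext1
    · exact hl n x
    · exact hr n x

/-- The right adjoint of `cylArrow`. -/
def cylPath : Arrow SSet.{0} ⥤ SSet.{0} where
  obj q :=
    { obj m := cylArrow.obj (stdSimplex.obj m.unop) ⟶ q
      map α := ↾fun g => cylArrow.map (SSet.stdSimplex.map α.unop) ≫ g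
      map_id m := by
        apply ConcreteCategory.hom_ext
        intro g
        have e : SSet.stdSimplex.{0}.map (𝟙 m.unop) = 𝟙 _ := CategoryTheory.Functor.map_id _ _
        refine (congrArg (fun k => cylArrow.map k ≫ g) e).trans ?_
        rw [cylArrow.map_id]
        exact Category.id_comp g
      map_comp α β := by
        apply ConcreteCategory.hom_ext
        intro g
        have e : SSet.stdSimplex.{0}.map (β.unop ≫ α.unop) = _ :=
          CategoryTheory.Functor.map_comp SSet.stdSimplex.{0} _ _
        refine (congrArg (fun k => cylArrow.map k ≫ g) e).trans ?_
        rw [cylArrow.map_comp]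
        exact Category.assoc (cylArrow.map (SSet.stdSimplex.map β.unop))
          (cylArrow.map (SSet.stdSimplex.map α.unop)) g }
  map u :=
    { app m := ↾fun g => g ≫ u
      naturality := by
        intro m m' α
        apply ConcreteCategory.hom_ext
        intro g
        exact Category.assoc (cylArrow.map (SSet.stdSimplex.map α.unop)) g u }
  map_id q := by
    apply hom_ext_apply
    intro m g
    exact Category.comp_id g
  map_comp u v := by
    apply hom_ext_apply
    intro m g
    exact (Category.assoc g u v).symm

/-- The transpose of a map out of `cylArrow.obj X`. -/
def cylTranspose {X : SSet.{0}} {q : Arrow SSet.{0}} (g : cylArrow.obj X ⟶ q) :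
    X ⟶ cylPath.obj q where
  app m := ↾fun x => cylArrow.map (SSet.yonedaEquiv.symm x) ≫ g
  naturality := by
    intro m m' α
    apply ConcreteCategory.hom_ext
    intro x
    show cylArrow.map (SSet.yonedaEquiv.symm (X.map α x)) ≫ g =
      cylArrow.map (SSet.stdSimplex.map α.unop) ≫ cylArrow.map (SSet.yonedaEquiv.symm x) ≫ g
    rw [← Category.assoc, ← Functor.map_comp]
    congr 2
    exact (yonedaEquiv_symm_naturality_left α.unop x).symm

theorem cylTranspose_bijective (X : SSet.{0}) (q : Arrow SSet.{0}) :
    Function.Bijective (cylTranspose (X := X) (q := q)) := by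
  constructor
  · intro g g' h
    refine cylArrow_hom_ext fun n x => ?_
    have := ConcreteCategory.congr_hom (NatTrans.congr_app h (Opposite.op n)) (SSet.yonedaEquiv x)
    have h' : cylArrow.map (SSet.yonedaEquiv.symm (SSet.yonedaEquiv x)) ≫ g =
      cylArrow.map (SSet.yonedaEquiv.symm (SSet.yonedaEquiv x)) ≫ g' := this
    rwa [Equiv.symm_apply_apply] at h'
  · intro u
    obtain ⟨g, hg⟩ := exists_cylArrow_desc (X := X) (q := q)
      (fun n x => u.app (Opposite.op n) (SSet.yonedaEquiv x)) (by
        intro n n' φ x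
        obtain ⟨φ, rfl⟩ := SSet.stdSimplex.map_surjective φ
        have := ConcreteCategory.congr_hom (u.naturality φ.op) (SSet.yonedaEquiv x)
        refine Eq.trans ?_ this
        exact congrArg (u.app _) (yonedaEquiv_naturality φ x).symm)
    refine ⟨g, ?_⟩
    apply hom_ext_apply
    intro m x
    refine (hg _ _).trans ?_
    exact congrArg (u.app m) (Equiv.apply_symm_apply _ _)

/-- The functor `cylArrow` is left adjoint to `cylPath`. -/
noncomputable def cylAdjunction : cylArrow ⊣ cylPath :=
  Adjunction.mkOfHomEquiv
    { homEquiv X q := Equiv.ofBijective _ (cylTranspose_bijective X q)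
      homEquiv_naturality_left_symm := by
        intro X' X q f g
        obtain ⟨g, rfl⟩ := (cylTranspose_bijective X q).2 g
        rw [Equiv.symm_apply_eq]
        erw [Equiv.ofBijective_symm_apply_apply]
        apply hom_ext_apply
        intro m x
        show cylArrow.map (SSet.yonedaEquiv.symm (f.app m x)) ≫ g =
          cylArrow.map (SSet.yonedaEquiv.symm x) ≫ cylArrow.map f ≫ g
        rw [← Category.assoc, ← Functor.map_comp, yonedaEquiv_symm_comp]
      homEquiv_naturality_right := by
        intro X q q' f g
        apply hom_ext_apply
        intro m x
        exact (Category.assoc (cylArrow.map (SSet.yonedaEquiv.symm x)) f g).symm }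

end Paper

namespace Paper

open HomotopicalAlgebra

open scoped SSet.modelCategoryQuillen

/-- The morphism of arrows from the identity of the source of `q` to `q`. -/
def arrowFromId {K L : SSet.{0}} (q : K ⟶ L) : Arrow.mk (𝟙 K) ⟶ Arrow.mk q :=
  Arrow.homMk (𝟙 K) q (by simp)

theorem hasLiftingProperty_of_leibniz {X Y P K L : SSet.{0}} (f : X ⟶ Y)
    {r : nerveSimplex.obj Y ⟶ P} {b : cyl.obj X ⟶ P}
    (h : IsPushout (nerveSimplex.map f) (cylι.app X) r b)
    (k : P ⟶ cyl.obj Y) (hr : r ≫ k = cylι.app Y) (hb : b ≫ k = cyl.map f) (q : K ⟶ L)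
    [HasLiftingProperty k q] : HasLiftingProperty f (cylPath.map (arrowFromId q)) := by
  rw [← cylAdjunction.hasLiftingProperty_iff]
  refine ⟨fun {u v} sq => ?_⟩
  obtain ⟨vl, hvl⟩ : ∃ vl : nerveSimplex.obj Y ⟶ K, vl = v.left := ⟨_, rfl⟩
  obtain ⟨vr, hvr⟩ : ∃ vr : cyl.obj Y ⟶ L, vr = v.right := ⟨_, rfl⟩
  obtain ⟨ur, hur⟩ : ∃ ur : cyl.obj X ⟶ K, ur = u.right := ⟨_, rfl⟩
  have hu : u.left = cylι.app X ≫ ur :=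
    (Category.comp_id u.left).symm.trans ((Arrow.w u).trans (by rw [hur]; rfl))
  have hl : nerveSimplex.map f ≫ vl = cylι.app X ≫ ur := by
    rw [hvl, ← hu]
    exact (congrArg CommaMorphism.left sq.w).symm.trans (Category.comp_id u.left)
  have hrt : ur ≫ q = cyl.map f ≫ vr := by
    rw [hur, hvr]
    exact congrArg CommaMorphism.right sq.w
  have hv : vl ≫ q = cylι.app Y ≫ vr := by
    rw [hvl, hvr]
    exact Arrow.w v
  have sq' : CommSq (h.desc vl ur hl) k q vr := ⟨by
    apply h.hom_ext
    · rw [h.inl_desc_assoc, reassoc_of% hr, hv]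
    · rw [h.inr_desc_assoc, reassoc_of% hb, hrt]⟩
  have h₁ : cylι.app Y ≫ sq'.lift = vl := by
    rw [← hr, Category.assoc, sq'.fac_left, h.inl_desc]
  have h₂ : cyl.map f ≫ sq'.lift = ur := by
    rw [← hb, Category.assoc, sq'.fac_left, h.inr_desc]
  refine ⟨⟨⟨Arrow.homMk vl sq'.lift ?_, ?_, ?_⟩⟩⟩
  · exact (Category.comp_id vl).trans h₁.symm
  · ext1
    · exact hl.trans hu.symm
    · exact h₂.trans hur
  · ext1
    · exact (Category.comp_id vl).trans hvl
    · exact sq'.fac_right.trans hvr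

theorem simplex_bot_false {X : SSet.{0}} {n : SimplexCategory}
    (x : stdSimplex.obj n ⟶ ((⊥ : X.Subcomplex) : SSet.{0})) : False :=
  (SSet.yonedaEquiv x).2

theorem hasLiftingProperty_cylι {X K L : SSet.{0}} (q : K ⟶ L)
    (h : HasLiftingProperty (⊥ : X.Subcomplex).ι (cylPath.map (arrowFromId q))) :
    HasLiftingProperty (cylι.app X) q := by
  rw [← cylAdjunction.hasLiftingProperty_iff] at h
  refine ⟨fun {a b} sq => ?_⟩
  obtain ⟨u, -⟩ := exists_cylArrow_desc (X := ((⊥ : X.Subcomplex) : SSet.{0}))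
    (q := Arrow.mk (𝟙 K)) (fun n x => (simplex_bot_false x).elim)
    (fun n n' φ x => (simplex_bot_false x).elim)
  let v : cylArrow.obj X ⟶ Arrow.mk q := Arrow.homMk a b sq.w
  have sq' : CommSq u (cylArrow.map (⊥ : X.Subcomplex).ι) (arrowFromId q) v :=
    ⟨cylArrow_hom_ext fun n x => (simplex_bot_false x).elim⟩
  have h₁ : sq'.lift.left ≫ 𝟙 K = a := congrArg CommaMorphism.left sq'.fac_right
  have h₂ : sq'.lift.left ≫ 𝟙 K = cylι.app X ≫ sq'.lift.right := Arrow.w sq'.lift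
  exact ⟨⟨⟨sq'.lift.right, h₂.symm.trans h₁, congrArg CommaMorphism.right sq'.fac_right⟩⟩⟩

/-- The right lifting property with respect to the boundary inclusions of dimension `< n` implies
the right lifting property with respect to the inclusion of the empty simplicial set in
simplicial sets of dimension `< n`. -/
theorem hasLiftingProperty_bot_of_hasDimensionLT {X E B : SSet.{0}} (n : ℕ) [X.HasDimensionLT n]
    (p : E ⟶ B) (hp : ∀ k < n, HasLiftingProperty (SSet.boundary.{0} k).ι p) :
    HasLiftingProperty (⊥ : X.Subcomplex).ι p := by
  let I : MorphismProperty SSet.{0} := .ofHoms fun k : Fin n => (SSet.boundary.{0} k).ι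
  have hI : I.rlp p := by
    rintro _ _ _ ⟨k⟩
    exact hp k k.2
  refine MorphismProperty.transfiniteCompositionsOfShape_pushouts_coproducts_le_llp_rlp.{0} I ℕ _
    ⟨(relativeCellComplex X).transfiniteCompositionOfShape' fun s => ?_⟩ _ hI
  exact MorphismProperty.ofHoms_iff _ _ |>.2
    ⟨⟨s.j, X.dim_lt_of_nonDegenerate ⟨s.k.simplex, s.k.nonDegenerate⟩ n⟩, rfl⟩

end Paper

namespace Paper

/-- The homotopy between nerves induced by a natural transformation. -/
def nerveHtpy {C D : Type} [Category.{0} C] [Category.{0} D] {F G : C ⥤ D} (α : F ⟶ G) :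
    nerve C ⊗ Δ[1] ⟶ nerve D where
  app m := ↾fun z => (Functor.prod'
    (stdSimplex.objEquiv (show (Δ[1] : SSet.{0}).obj m from z.2)).toOrderHom.monotone.functor
    (show ComposableArrows C m.unop.len from z.1)) ⋙ Functor.uncurry.obj (ComposableArrows.mk₁ α)

theorem homotopy_nerveMap {C D : Type} [Category.{0} C] [Category.{0} D] {F G : C ⥤ D}
    (α : F ⟶ G) : Homotopy (nerveMap F) (nerveMap G) := by
  refine ⟨nerveHtpy α, ?_, ?_⟩
  · apply hom_ext_apply
    intro m (f : ComposableArrows _ _)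
    refine CategoryTheory.Functor.ext (fun i => rfl) fun i j g => ?_
    refine Eq.trans (Category.id_comp (F.map (f.map g))) ?_
    exact ((Category.id_comp _).trans (Category.comp_id (F.map (f.map g)))).symm
  · apply hom_ext_apply
    intro m (f : ComposableArrows _ _)
    refine CategoryTheory.Functor.ext (fun i => rfl) fun i j g => ?_
    refine Eq.trans (Category.id_comp (G.map (f.map g))) ?_
    exact ((Category.id_comp _).trans (Category.comp_id (G.map (f.map g)))).symm

/-- The map from `Δ[0]` to a nerve given by an object. -/
def nervePt {C : Type} [Category.{0} C] (t : C) : Δ[0] ⟶ nerve C where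
  app m := ↾fun _ => (Functor.const _).obj t

theorem exists_homotopy_nerveSimplex (n : ℕ) : ∃ p₀ : Δ[0] ⟶ nerveSimplex.obj Δ[n],
    Homotopy (𝟙 (nerveSimplex.obj Δ[n])) (toPt _ ≫ p₀) := by
  let t : SimplexOf (Δ[n] : SSet.{0}) := ⟨⦋n⦌, stdSimplex.objEquiv.symm (𝟙 _)⟩
  let α : 𝟭 (SimplexOf (Δ[n] : SSet.{0})) ⟶ (Functor.const (SimplexOf (Δ[n] : SSet.{0}))).obj t :=
    { app a := ⟨stdSimplex.objEquiv a.pt, by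
        apply stdSimplex.objEquiv.injective
        exact Category.comp_id (stdSimplex.objEquiv a.pt)⟩
      naturality a b φ := by
        apply Subtype.ext
        refine Eq.trans ?_ (Category.comp_id (stdSimplex.objEquiv a.pt)).symm
        exact congrArg stdSimplex.objEquiv φ.2 }
  exact ⟨nervePt t, homotopy_nerveMap α⟩

/-- The contraction of the standard simplex on its last vertex. -/
def simplexHtpy (n : ℕ) : Δ[n] ⊗ Δ[1] ⟶ (Δ[n] : SSet.{0}) where
  app m := ↾fun z => stdSimplex.objEquiv.symm (SimplexCategory.Hom.mk
    { toFun j := if (stdSimplex.objEquiv (show (Δ[1] : SSet.{0}).obj m from z.2)).toOrderHom j = 0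
        then (stdSimplex.objEquiv (show (Δ[n] : SSet.{0}).obj m from z.1)).toOrderHom j
        else Fin.last _
      monotone' := by
        intro i j hij
        have h₁ := (stdSimplex.objEquiv
          (show (Δ[1] : SSet.{0}).obj m from z.2)).toOrderHom.monotone hij
        have h₂ := (stdSimplex.objEquiv
          (show (Δ[n] : SSet.{0}).obj m from z.1)).toOrderHom.monotone hij
        dsimp only
        split_ifs with h h' h'
        · exact h₂
        · exact Fin.le_last _
        · rw [h'] at h₁
          exact (h (Fin.le_zero_iff.1 h₁)).elim
        · exact le_rfl })

theorem exists_homotopy_stdSimplex (n : ℕ) : ∃ p₀ : Δ[0] ⟶ (Δ[n] : SSet.{0}),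
    Homotopy (𝟙 Δ[n]) (toPt _ ≫ p₀) := by
  refine ⟨SSet.yonedaEquiv.symm (SSet.stdSimplex.const n (Fin.last n) _), simplexHtpy n, ?_, ?_⟩
  · apply hom_ext_apply
    intro m x
    apply stdSimplex.objEquiv.injective
    apply SimplexCategory.Hom.ext
    apply OrderHom.ext
    funext j
    show (if (0 : Fin 2) = 0 then (stdSimplex.objEquiv x).toOrderHom j else Fin.last n) = _
    exact if_pos rfl
  · rfl

theorem exists_homotopies_cyl (n : ℕ) : ∃ p₀ : Δ[0] ⟶ cyl.obj Δ[n],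
    Relation.ReflTransGen Homotopy (𝟙 (cyl.obj Δ[n])) (toPt _ ≫ p₀) := by
  obtain ⟨p₀, hp⟩ := exists_homotopy_stdSimplex n
  refine ⟨p₀ ≫ cylEnd _, .head (homotopy_cylDef _) (.single ?_)⟩
  exact hp.whisker (cylRet _) (cylEnd _)

end Paper

namespace Paper

open CartesianMonoidalCategory HomotopicalAlgebra

open scoped SSet.modelCategoryQuillen

theorem hasLiftingProperty_boundary (n : ℕ) :
    ∀ {K L : SSet.{0}} (q : K ⟶ L) [Fibration q],
      HasLiftingProperty (SSet.boundary.{0} n).ι (cylPath.map (arrowFromId q)) := by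
  induction n using Nat.strong_induction_on with
  | _ n ih =>
    have h₁ : anodyneExtensions (cylι.app (SSet.boundary.{0} n : SSet.{0})) := by
      intro K L q hq
      have : Fibration q := (fibration_iff q).2 hq
      exact hasLiftingProperty_cylι q
        (hasLiftingProperty_bot_of_hasDimensionLT n _ fun k hk => ih k hk q)
    let f := (SSet.boundary.{0} n).ι
    have hpo := IsPushout.of_hasPushout (nerveSimplex.map f) (cylι.app _)
    let k := hpo.desc (cylι.app Δ[n]) (cyl.map f) (cylι.naturality f)
    have hr := hpo.inl_desc (cylι.app Δ[n]) (cyl.map f) (cylι.naturality f)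
    have hb := hpo.inr_desc (cylι.app Δ[n]) (cyl.map f) (cylι.naturality f)
    have : Mono k := mono_cyl_leibniz f hpo k hr hb
    obtain ⟨p₀, hp⟩ := exists_homotopy_nerveSimplex n
    obtain ⟨b₀, hb₀⟩ := exists_homotopies_cyl n
    have hk : anodyneExtensions k := anodyneExtensions_of_contractible _
      (MorphismProperty.of_isPushout (P := anodyneExtensions) hpo h₁) k p₀ hp b₀ hb₀
    intro K L q hq
    have : HasLiftingProperty k q := hk q (mem_fibrations q)
    exact hasLiftingProperty_of_leibniz f hpo k hr hb q

/-- The inclusion of the nerve of the category of simplices in the mapping cylinder of `tau` is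
anodyne. -/
theorem anodyneExtensions_cylι (X : SSet.{0}) : anodyneExtensions (cylι.app X) := by
  intro K L q hq
  have : Fibration q := (fibration_iff q).2 hq
  have h : (MorphismProperty.monomorphisms SSet.{0}).rlp (cylPath.map (arrowFromId q)) := by
    rw [rlp_monomorphisms]
    rintro _ _ _ ⟨n⟩
    exact hasLiftingProperty_boundary n q
  exact hasLiftingProperty_cylι q (h _ (MorphismProperty.monomorphisms.infer_property _))

theorem KanComplex.fibration {K : SSet.{0}} (hK : KanComplex K) : Fibration (toPt K) := by
  rw [fibration_iff]
  intro A B i hi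
  simp only [modelCategoryQuillen.J, MorphismProperty.iSup_iff] at hi
  obtain ⟨n, ⟨i⟩⟩ := hi
  exact hK n i

/-- Restriction along an anodyne map of maps from a product to a Kan complex. -/
theorem exists_extension_tensor {D M K : SSet.{0}} (i : D ⟶ M) (hi : anodyneExtensions i)
    [Fibration (toPt K)] (Z : SSet.{0}) (u : D ⊗ Z ⟶ K) : ∃ v : M ⊗ Z ⟶ K, i ▷ Z ≫ v = u := by
  have : HasLiftingProperty (i ▷ Z) (toPt K) := hi.whiskerRight Z _ (mem_fibrations _)
  have sq : CommSq u (i ▷ Z) (toPt K) (toPt _) := ⟨rfl⟩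
  exact ⟨sq.lift, sq.fac_left⟩

/-- Homotopies between maps from a product transpose to homotopies between maps to an
exponential. -/
theorem homotopy_curry {A Y K : SSet.{0}} {f g : A ⊗ Y ⟶ K} (h : Homotopy f g) :
    Homotopy (MonoidalClosed.curry f) (MonoidalClosed.curry g) := by
  obtain ⟨H, h₀, h₁⟩ := h
  refine ⟨MonoidalClosed.curry ((α_ A Y Δ[1]).inv ≫ H), ?_, ?_⟩
  · rw [← MonoidalClosed.curry_natural_left, ← h₀]
    rfl
  · rw [← MonoidalClosed.curry_natural_left, ← h₁]
    rfl

theorem Homotopy.tensor {X Y : SSet.{0}} {f g : X ⟶ Y} (h : Homotopy f g) (Z : SSet.{0}) :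
    Homotopy (f ▷ Z) (g ▷ Z) := by
  obtain ⟨H, h₀, h₁⟩ := h
  refine ⟨lift (fst X Z ▷ Δ[1] ≫ H) (fst (X ⊗ Z) Δ[1] ≫ snd X Z), ?_, ?_⟩
  · rw [← h₀]
    rfl
  · rw [← h₁]
    rfl

theorem weakHomotopyEquivalence_of_cylinder {D X M : SSet.{0}} (τ : D ⟶ X) (i : D ⟶ M)
    (hi : anodyneExtensions i) (e : X ⟶ M) (r : M ⟶ X) (her : e ≫ r = 𝟙 X) (hir : i ≫ r = τ)
    (h : Homotopy i (τ ≫ e)) : WeakHomotopyEquivalence τ := by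
  intro K hK
  have := hK.fibration
  obtain ⟨v, hv⟩ : ∃ v : M ⊗ (ihom D).obj K ⟶ K, i ▷ _ ≫ v = (ihom.ev D).app K :=
    exists_extension_tensor i hi ((ihom D).obj K) _
  refine ⟨MonoidalClosed.curry (e ▷ _ ≫ v), .rel _ _ ?_, .symm _ _ (.rel _ _ ?_)⟩
  · rw [← MonoidalClosed.curry_natural_left, ← MonoidalClosed.curry_uncurry (𝟙 ((ihom X).obj K)),
      MonoidalClosed.uncurry_id_eq_ev]
    apply homotopy_curry
    have hj : anodyneExtensions (i ▷ (ihom X).obj K) := hi.whiskerRight _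
    obtain ⟨H, hH, -⟩ := exists_homotopy_of_anodyne _ hj
      ![M ◁ (MonoidalClosed.pre τ).app K ≫ v, r ▷ _ ≫ (ihom.ev X).app K]
      (fst _ _ ≫ τ ▷ _ ≫ (ihom.ev X).app K) (by
        intro k
        rw [ept_fst_assoc]
        fin_cases k
        · show _ = i ▷ _ ≫ M ◁ (MonoidalClosed.pre τ).app K ≫ v
          rw [← MonoidalCategory.whisker_exchange_assoc, hv,
            MonoidalClosed.id_tensor_pre_app_comp_ev]
        · show _ = i ▷ _ ≫ r ▷ _ ≫ (ihom.ev X).app K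
          rw [← MonoidalCategory.comp_whiskerRight_assoc, hir])
    refine ⟨(e ▷ _) ▷ Δ[1] ≫ H, ?_, ?_⟩
    · rw [ept_naturality_assoc, hH 0, MonoidalCategory.whisker_exchange_assoc]
      rfl
    · rw [ept_naturality_assoc, hH 1]
      show e ▷ _ ≫ r ▷ _ ≫ (ihom.ev X).app K = _
      rw [← MonoidalCategory.comp_whiskerRight_assoc, her, MonoidalCategory.id_whiskerRight,
        Category.id_comp]
  · rw [MonoidalClosed.curry_pre_app, ← MonoidalClosed.curry_uncurry (𝟙 ((ihom D).obj K)),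
      MonoidalClosed.uncurry_id_eq_ev, ← hv, ← MonoidalCategory.comp_whiskerRight_assoc]
    apply homotopy_curry
    have := (h.tensor ((ihom D).obj K)).whisker (𝟙 _) v
    rwa [Category.id_comp, Category.id_comp] at this

end Paper

/-- For every simplicial set `X`, the canonical map
`τ_X : N(Δ ↓ X) ⟶ X` is a weak homotopy equivalence. -/
theorem tau_weakHomotopyEquivalence (X : SSet.{0}) :
    Paper.WeakHomotopyEquivalence (Paper.tau X) :=
  Paper.weakHomotopyEquivalence_of_cylinder _ _ (Paper.anodyneExtensions_cylι X)
    (Paper.cylEnd X) (Paper.cylRet X) (Paper.cylEnd_ret X) (Paper.cylι_ret X)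
    (Paper.homotopy_cylι X)
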